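/- Let 1 ≤ p, q ≤ 2 with 1/p + 1/q ≤ 3/2. Then for every continuous bilinear form A : c₀ × c₀ → ℝ, ( Σ_{k=1}^{∞} ( Σ_{j=1}^{∞} |A(e_k, e_j)|^q )^{p/q} )^{1/p} ≤ 2^{1/p + 1/q − 1} ‖A‖. -/

import Mathlib

open scoped ENNReal NNReal

/-- The canonical unit vectors of `c₀`, the space of null sequences with the sup norm. -/
noncomputable def unitVec (𝕂 : Type*) [RCLike 𝕂] (i : ℕ) : ZeroAtInftyContinuousMap ℕ 𝕂 :=
  { toFun := fun j => if j = i then 1 else 0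
    continuous_toFun := continuous_of_discreteTopology
    zero_at_infty' := by
      rw [Filter.cocompact_eq_cofinite]
      refine Filter.Tendsto.congr' ?_ tendsto_const_nhds
      filter_upwards [Filter.eventually_cofinite_ne i] with j hj
      simp [hj] }

/-- The real sign attached to a Boolean. -/
def boolSign (b : Bool) : ℝ := if b then 1 else -1

@[simp] lemma boolSign_true : boolSign true = 1 := rfl

@[simp] lemma boolSign_false : boolSign false = -1 := rfl

@[simp] lemma boolSign_not (b : Bool) : boolSign (!b) = -boolSign b := by cases b <;> simp

lemma abs_boolSign (b : Bool) : |boolSign b| = 1 := by cases b <;> simp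

/-- The mean of a function on the discrete cube. -/
noncomputable def cubeMean {n : ℕ} (f : (Fin n → Bool) → ℝ) : ℝ := (2 ^ n)⁻¹ * ∑ ε, f ε

/-- Flip one coordinate of a point of the discrete cube. -/
def cubeFlip {n : ℕ} (i : Fin n) (ε : Fin n → Bool) : Fin n → Bool :=
  Function.update ε i (!ε i)

/-- The Dirichlet energy of a function on the discrete cube. -/
noncomputable def cubeEnergy {n : ℕ} (f : (Fin n → Bool) → ℝ) : ℝ :=
  ∑ i, cubeMean fun ε => (f ε - f (cubeFlip i ε)) ^ 2

section CubeMean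

variable {n : ℕ} (f g : (Fin n → Bool) → ℝ)

lemma cubeMean_add : cubeMean (fun ε => f ε + g ε) = cubeMean f + cubeMean g := by
  simp [cubeMean, Finset.sum_add_distrib, mul_add]

lemma cubeMean_sub : cubeMean (fun ε => f ε - g ε) = cubeMean f - cubeMean g := by
  simp [cubeMean, Finset.sum_sub_distrib, mul_sub]

lemma cubeMean_const_mul (c : ℝ) : cubeMean (fun ε => c * f ε) = c * cubeMean f := by
  simp only [cubeMean, ← Finset.mul_sum]; ring

lemma cubeMean_const (c : ℝ) : cubeMean (fun _ : Fin n → Bool => c) = c := by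
  simp [cubeMean]

lemma cubeMean_sum {ι : Type*} (s : Finset ι) (F : ι → (Fin n → Bool) → ℝ) :
    cubeMean (fun ε => ∑ i ∈ s, F i ε) = ∑ i ∈ s, cubeMean (F i) := by
  simp only [cubeMean, Finset.mul_sum]
  exact Finset.sum_comm

variable {f g} in
lemma cubeMean_mono (h : ∀ ε, f ε ≤ g ε) : cubeMean f ≤ cubeMean g :=
  mul_le_mul_of_nonneg_left (Finset.sum_le_sum fun ε _ => h ε) (by positivity)

lemma cubeMean_comp (e : (Fin n → Bool) ≃ (Fin n → Bool)) :
    cubeMean (fun ε => f (e ε)) = cubeMean f := by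
  simp only [cubeMean, Equiv.sum_comp e f]

lemma cubeMean_sq_le : cubeMean f ^ 2 ≤ cubeMean fun ε => f ε ^ 2 := by
  have h : 0 ≤ cubeMean fun ε => (f ε ^ 2 - 2 * cubeMean f * f ε) + cubeMean f ^ 2 := by
    rw [← cubeMean_const (n := n) 0]
    exact cubeMean_mono fun ε => by nlinarith [sq_nonneg (f ε - cubeMean f)]
  rw [cubeMean_add, cubeMean_sub, cubeMean_const_mul, cubeMean_const] at h
  nlinarith

lemma cubeMean_succ (f : (Fin (n + 1) → Bool) → ℝ) :
    cubeMean f = (cubeMean (fun ε => f (Fin.cons true ε)) +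
      cubeMean (fun ε => f (Fin.cons false ε))) / 2 := by
  have h : ∑ ε, f ε = ∑ ε : Fin n → Bool, f (Fin.cons true ε) +
      ∑ ε : Fin n → Bool, f (Fin.cons false ε) := by
    rw [← (Fin.consEquiv fun _ : Fin (n + 1) => Bool).sum_comp, Fintype.sum_prod_type,
      Fintype.sum_bool]
    rfl
  simp only [cubeMean, h, pow_succ, mul_inv]
  ring

lemma cubeFlip_involutive (i : Fin n) : Function.Involutive (cubeFlip i) := by
  intro ε
  simp [cubeFlip]

lemma cubeFlip_zero_cons (b : Bool) (ε : Fin n → Bool) :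
    cubeFlip 0 (Fin.cons b ε : Fin (n + 1) → Bool) = Fin.cons (!b) ε := by
  simp [cubeFlip]

lemma cubeFlip_succ_cons (i : Fin n) (b : Bool) (ε : Fin n → Bool) :
    cubeFlip i.succ (Fin.cons b ε : Fin (n + 1) → Bool) = Fin.cons b (cubeFlip i ε) := by
  simp [cubeFlip, Fin.cons_update]

lemma cubeEnergy_succ (f : (Fin (n + 1) → Bool) → ℝ) :
    cubeEnergy f =
      cubeMean (fun ε : Fin n → Bool => (f (Fin.cons true ε) - f (Fin.cons false ε)) ^ 2) +
      (cubeEnergy (fun ε => f (Fin.cons true ε)) +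
        cubeEnergy (fun ε => f (Fin.cons false ε))) / 2 := by
  simp only [cubeEnergy, Fin.sum_univ_succ, cubeMean_succ, cubeFlip_zero_cons,
    cubeFlip_succ_cons, ← Finset.sum_add_distrib, ← Finset.sum_div, Bool.not_true, Bool.not_false]
  have h (ε : Fin n → Bool) : (f (Fin.cons false ε) - f (Fin.cons true ε)) ^ 2 =
      (f (Fin.cons true ε) - f (Fin.cons false ε)) ^ 2 := sub_sq_comm _ _
  simp only [h]
  ring

lemma cubeEnergy_parallelogram :
    cubeEnergy (fun ε => g ε + f ε) + cubeEnergy (fun ε => g ε - f ε) =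
      2 * (cubeEnergy g + cubeEnergy f) := by
  simp only [cubeEnergy, ← Finset.sum_add_distrib, Finset.mul_sum, ← cubeMean_add,
    ← cubeMean_const_mul]
  refine Finset.sum_congr rfl fun i _ => congrArg cubeMean (funext fun ε => ?_)
  ring

/-- The Poincaré inequality on the discrete cube. -/
lemma four_mul_variance_le_cubeEnergy :
    4 * (cubeMean (fun ε => f ε ^ 2) - cubeMean f ^ 2) ≤ cubeEnergy f := by
  induction n with
  | zero => simp [cubeMean, cubeEnergy]
  | succ n ih =>
    rw [cubeEnergy_succ, cubeMean_succ, cubeMean_succ f]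
    have h₁ := ih fun ε => f (Fin.cons true ε)
    have h₂ := ih fun ε => f (Fin.cons false ε)
    have h₃ := cubeMean_sq_le fun ε : Fin n → Bool => f (Fin.cons true ε) - f (Fin.cons false ε)
    rw [cubeMean_sub] at h₃
    nlinarith

/-- A second-level Poincaré inequality on the discrete cube: the spectral gap doubles once the
Walsh coefficients of degree one are accounted for. -/
lemma eight_mul_variance_le_cubeEnergy_add :
    8 * (cubeMean (fun ε => f ε ^ 2) - cubeMean f ^ 2) ≤
      cubeEnergy f + 4 * ∑ i, cubeMean (fun ε => boolSign (ε i) * f ε) ^ 2 := by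
  induction n with
  | zero => simp [cubeMean, cubeEnergy]
  | succ n ih =>
    obtain ⟨g, h, h₁, h₀⟩ : ∃ g h : (Fin n → Bool) → ℝ,
        (∀ ε, f (Fin.cons true ε) = g ε + h ε) ∧ ∀ ε, f (Fin.cons false ε) = g ε - h ε :=
      ⟨fun ε => (f (Fin.cons true ε) + f (Fin.cons false ε)) / 2,
        fun ε => (f (Fin.cons true ε) - f (Fin.cons false ε)) / 2,
        fun ε => by ring, fun ε => by ring⟩
    have hsq : cubeMean (fun ε => f ε ^ 2) =
        cubeMean (fun ε => g ε ^ 2) + cubeMean (fun ε => h ε ^ 2) := by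
      rw [cubeMean_succ]
      simp only [h₁, h₀, ← cubeMean_add, div_eq_inv_mul, ← cubeMean_const_mul]
      exact congrArg cubeMean (funext fun ε => by ring)
    have hmean : cubeMean f = cubeMean g := by
      rw [cubeMean_succ]
      simp only [h₁, h₀, cubeMean_add, cubeMean_sub]
      ring
    have hen : cubeEnergy f =
        4 * cubeMean (fun ε => h ε ^ 2) + (cubeEnergy g + cubeEnergy h) := by
      rw [cubeEnergy_succ]
      simp only [h₁, h₀, cubeEnergy_parallelogram, ← cubeMean_const_mul]
      rw [mul_div_cancel_left₀ _ two_ne_zero]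
      exact congrArg (· + _) (congrArg cubeMean (funext fun ε => by ring))
    have hzero : cubeMean (fun ε => boolSign (ε 0) * f ε) = cubeMean h := by
      rw [cubeMean_succ]
      simp only [h₁, h₀, Fin.cons_zero, boolSign_true, boolSign_false, cubeMean_const_mul,
        cubeMean_add, cubeMean_sub]
      ring
    have hsucc (i : Fin n) : cubeMean (fun ε => boolSign (ε i.succ) * f ε) =
        cubeMean fun ε => boolSign (ε i) * g ε := by
      rw [cubeMean_succ]
      simp only [h₁, h₀, Fin.cons_succ, mul_add, mul_sub, cubeMean_add, cubeMean_sub]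
      ring
    rw [hsq, hmean, hen, Fin.sum_univ_succ, hzero]
    simp only [hsucc]
    linarith [ih g, four_mul_variance_le_cubeEnergy h]

end CubeMean

section Khinchine

variable {n : ℕ} (a : Fin n → ℝ)

lemma cubeMean_sq_sum : cubeMean (fun ε => (∑ i, a i * boolSign (ε i)) ^ 2) = ∑ i, a i ^ 2 := by
  induction n with
  | zero => simp [cubeMean]
  | succ n ih =>
    rw [cubeMean_succ, Fin.sum_univ_succ, ← ih, ← cubeMean_const (n := n) (a 0 ^ 2)]
    simp only [Fin.sum_univ_succ, Fin.cons_zero, Fin.cons_succ, boolSign_true, boolSign_false,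
      ← cubeMean_add, div_eq_inv_mul, ← cubeMean_const_mul]
    exact congrArg cubeMean (funext fun ε => by ring)

lemma sum_sum_mul_boolSign_cubeFlip (ε : Fin n → Bool) :
    ∑ i, ∑ j, a j * boolSign (cubeFlip i ε j) = (n - 2) * ∑ j, a j * boolSign (ε j) := by
  rw [Finset.sum_comm, Finset.mul_sum]
  refine Finset.sum_congr rfl fun j _ => ?_
  have h (i : Fin n) : a j * boolSign (cubeFlip i ε j) =
      a j * boolSign (ε j) - if j = i then 2 * (a j * boolSign (ε j)) else 0 := by
    rw [cubeFlip, Function.update_apply]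
    split_ifs with hij
    · subst hij
      rw [boolSign_not]
      ring
    · ring
  simp only [h, Finset.sum_sub_distrib, Finset.sum_ite_eq, Finset.mem_univ, if_true,
    Finset.sum_const, Finset.card_univ, Fintype.card_fin, nsmul_eq_mul]
  ring

lemma cubeEnergy_abs_sum_le :
    cubeEnergy (fun ε => |∑ i, a i * boolSign (ε i)|) ≤ 4 * ∑ i, a i ^ 2 := by
  set f : (Fin n → Bool) → ℝ := fun ε => |∑ i, a i * boolSign (ε i)| with hf
  have hmean : cubeMean (fun ε => f ε ^ 2) = ∑ i, a i ^ 2 := by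
    simp only [hf, sq_abs, cubeMean_sq_sum]
  have hflip (i : Fin n) : cubeMean (fun ε => f (cubeFlip i ε) ^ 2) = ∑ i, a i ^ 2 :=
    (cubeMean_comp (fun ε => f ε ^ 2) (cubeFlip_involutive i).toPerm).trans hmean
  have hexp : cubeEnergy f =
      2 * n * ∑ i, a i ^ 2 - 2 * cubeMean (fun ε => f ε * ∑ i, f (cubeFlip i ε)) := by
    have h (i : Fin n) : cubeMean (fun ε => (f ε - f (cubeFlip i ε)) ^ 2) =
        2 * ∑ i, a i ^ 2 - 2 * cubeMean (fun ε => f ε * f (cubeFlip i ε)) := by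
      have h' : (fun ε => (f ε - f (cubeFlip i ε)) ^ 2) = fun ε =>
          (f ε ^ 2 + f (cubeFlip i ε) ^ 2) - 2 * (f ε * f (cubeFlip i ε)) := by
        ext ε
        ring
      rw [h', cubeMean_sub, cubeMean_add, cubeMean_const_mul, hmean, hflip]
      ring
    simp only [cubeEnergy, h, Finset.mul_sum _ (fun i => f (cubeFlip i _)), cubeMean_sum]
    simp only [Finset.sum_sub_distrib, ← Finset.mul_sum, Finset.sum_const, Finset.card_univ,
      Fintype.card_fin, nsmul_eq_mul]
    ring
  have hle : (n - 2) * ∑ i, a i ^ 2 ≤ cubeMean (fun ε => f ε * ∑ i, f (cubeFlip i ε)) := by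
    rw [← hmean, ← cubeMean_const_mul]
    refine cubeMean_mono fun ε => ?_
    have h : (n - 2) * f ε ≤ ∑ i, f (cubeFlip i ε) := calc
      (n - 2) * f ε ≤ |(n - 2 : ℝ)| * f ε :=
        mul_le_mul_of_nonneg_right (le_abs_self _) (abs_nonneg _)
      _ = |∑ i, ∑ j, a j * boolSign (cubeFlip i ε j)| := by
        rw [sum_sum_mul_boolSign_cubeFlip, abs_mul]
      _ ≤ ∑ i, f (cubeFlip i ε) := Finset.abs_sum_le_sum_abs _ _
    nlinarith [mul_le_mul_of_nonneg_left h (abs_nonneg _ : 0 ≤ f ε)]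
  rw [hexp]
  linarith

/-- Khinchine's inequality in `L¹` with the sharp constant `√2` (Szarek), following the argument
of Latała and Oleszkiewicz. -/
theorem sqrt_sum_sq_le_cubeMean_abs :
    √(∑ i, a i ^ 2) ≤ √2 * cubeMean (fun ε => |∑ i, a i * boolSign (ε i)|) := by
  have h := eight_mul_variance_le_cubeEnergy_add fun ε => |∑ i, a i * boolSign (ε i)|
  have hodd (i : Fin n) :
      cubeMean (fun ε => boolSign (ε i) * |∑ j, a j * boolSign (ε j)|) = 0 := by
    have hinv : Function.Involutive fun (ε : Fin n → Bool) j => !ε j := fun ε => by simp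
    have h := cubeMean_comp (fun ε => boolSign (ε i) * |∑ j, a j * boolSign (ε j)|) hinv.toPerm
    simp only [Function.Involutive.coe_toPerm, boolSign_not, mul_neg, Finset.sum_neg_distrib,
      abs_neg, neg_mul] at h
    have h' := cubeMean_const_mul
      (fun ε : Fin n → Bool => boolSign (ε i) * |∑ j, a j * boolSign (ε j)|) (-1)
    simp only [neg_one_mul] at h'
    linarith
  simp only [hodd, sq_abs, cubeMean_sq_sum] at h
  have hnn : 0 ≤ cubeMean fun ε => |∑ i, a i * boolSign (ε i)| := by
    rw [← cubeMean_const (n := n) 0]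
    exact cubeMean_mono fun ε => abs_nonneg _
  refine Real.sqrt_le_iff.2 ⟨by positivity, ?_⟩
  rw [mul_pow, Real.sq_sqrt zero_le_two]
  simp only [ne_eq, OfNat.ofNat_ne_zero, not_false_eq_true, zero_pow, Finset.sum_const_zero] at h
  linarith [cubeEnergy_abs_sum_le a]

end Khinchine

/-- `M` bounds the bilinear form with real matrix `a` on every pair of vectors of the unit ball
of finite support. -/
def BilinBound (a : ℕ → ℕ → ℝ) (M : ℝ) : Prop :=
  ∀ (m n : ℕ) (σ τ : ℕ → ℝ), (∀ k, |σ k| ≤ 1) → (∀ j, |τ j| ≤ 1) →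
    ∑ k ∈ Finset.range m, ∑ j ∈ Finset.range n, σ k * τ j * a k j ≤ M

namespace BilinBound

variable {a : ℕ → ℕ → ℝ} {M : ℝ}

lemma transpose (h : BilinBound a M) : BilinBound (fun j k => a k j) M := by
  intro m n σ τ hσ hτ
  rw [Finset.sum_comm]
  simpa only [mul_comm (σ _)] using h n m τ σ hτ hσ

lemma nonneg (h : BilinBound a M) : 0 ≤ M := by
  simpa using h 0 0 (fun _ => 0) (fun _ => 0) (by simp) (by simp)

lemma sum_abs_le (h : BilinBound a M) (m : ℕ) {n : ℕ} (ε : Fin n → Bool) :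
    ∑ k ∈ Finset.range m, |∑ j : Fin n, a k j * boolSign (ε j)| ≤ M := by
  have h' := h m n (fun k => SignType.sign (∑ j : Fin n, a k j * boolSign (ε j)))
    (fun j => if hj : j < n then boolSign (ε ⟨j, hj⟩) else 0) ?_ ?_
  · convert h' using 2 with k
    rw [← sign_mul_self, Finset.mul_sum, Finset.sum_range]
    refine Finset.sum_congr rfl fun j _ => ?_
    simp only [j.2, dite_true]
    ring
  · intro k
    rcases (SignType.sign (∑ j : Fin n, a k j * boolSign (ε j))) with _ | _ | _ <;> simp
  · intro j
    split_ifs <;> simp [abs_boolSign]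

lemma sum_sqrt_le (h : BilinBound a M) (m n : ℕ) :
    ∑ k ∈ Finset.range m, √(∑ j ∈ Finset.range n, a k j ^ 2) ≤ √2 * M := by
  simp only [Finset.sum_range fun j => a _ j ^ 2]
  calc ∑ k ∈ Finset.range m, √(∑ j : Fin n, a k j ^ 2)
      ≤ ∑ k ∈ Finset.range m, √2 * cubeMean fun ε => |∑ j : Fin n, a k j * boolSign (ε j)| :=
        Finset.sum_le_sum fun k _ => sqrt_sum_sq_le_cubeMean_abs _
    _ = √2 * cubeMean fun ε : Fin n → Bool =>
          ∑ k ∈ Finset.range m, |∑ j : Fin n, a k j * boolSign (ε j)| := by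
        rw [cubeMean_sum, Finset.mul_sum]
    _ ≤ √2 * cubeMean fun _ : Fin n → Bool => M := by
        gcongr
        exact cubeMean_mono fun ε => h.sum_abs_le m ε
    _ = √2 * M := by rw [cubeMean_const]

lemma sum_sum_sq_le (h : BilinBound a M) (m n : ℕ) :
    ∑ k ∈ Finset.range m, ∑ j ∈ Finset.range n, a k j ^ 2 ≤ M ^ 2 := by
  simp only [Finset.sum_range fun j => a _ j ^ 2, ← cubeMean_sq_sum, ← cubeMean_sum]
  rw [← cubeMean_const (n := n) (M ^ 2)]
  refine cubeMean_mono fun ε => ?_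
  have hM := h.sum_abs_le m ε
  calc ∑ k ∈ Finset.range m, (∑ j : Fin n, a k j * boolSign (ε j)) ^ 2
      ≤ ∑ k ∈ Finset.range m, M * |∑ j : Fin n, a k j * boolSign (ε j)| := by
        refine Finset.sum_le_sum fun k hk => ?_
        rw [← sq_abs, sq]
        gcongr
        exact (Finset.single_le_sum
          (f := fun k => |∑ j : Fin n, a k j * boolSign (ε j)|)
          (fun _ _ => abs_nonneg _) hk).trans hM
    _ ≤ M ^ 2 := by
        rw [← Finset.mul_sum, sq]
        exact mul_le_mul_of_nonneg_left hM h.nonneg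

end BilinBound

namespace ENNReal

lemma tsum_tsum_rpow_le_of_sum_range_le {x : ℕ → ℕ → ℝ≥0∞} {C : ℝ≥0∞} {s : ℝ}
    (h : ∀ m n, ∑ k ∈ Finset.range m, (∑ j ∈ Finset.range n, x k j) ^ s ≤ C) :
    ∑' k, (∑' j, x k j) ^ s ≤ C :=
  le_of_tendsto' (ENNReal.tendsto_nat_tsum _) fun m =>
    le_of_tendsto' (tendsto_finsetSum _ fun k _ =>
      ((ENNReal.continuous_rpow_const (y := s)).tendsto _).comp
        (ENNReal.tendsto_nat_tsum (x k))) (h m)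

/-- Hölder's inequality for a product of three powers with weights of sum one. -/
lemma tsum_mul_mul_rpow_le (f g h : ℕ → ℝ≥0∞) {u v w : ℝ} (hu : 0 ≤ u) (hv : 0 ≤ v)
    (hw : 0 ≤ w) (huvw : u + v + w = 1) :
    ∑' k, f k ^ u * g k ^ v * h k ^ w ≤
      (∑' k, f k) ^ u * (∑' k, g k) ^ v * (∑' k, h k) ^ w := by
  have := ENNReal.lintegral_prod_norm_pow_le (μ := MeasureTheory.Measure.count)
    Finset.univ (f := ![f, g, h]) (p := ![u, v, w])
    (fun i _ => (measurable_of_countable _).aemeasurable)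
    (by simpa [Fin.sum_univ_three] using huvw)
    (fun i _ => by fin_cases i <;> assumption)
  simpa [Fin.prod_univ_three, MeasureTheory.lintegral_count] using this

/-- Minkowski's inequality for mixed `ℓ¹` and `ℓ²` sums. -/
lemma tsum_tsum_sq_le (x : ℕ → ℕ → ℝ≥0∞) :
    ∑' k, (∑' j, x k j) ^ (2 : ℝ) ≤ (∑' j, (∑' k, x k j ^ (2 : ℝ)) ^ (1 / 2 : ℝ)) ^ (2 : ℝ) := by
  have hmul (f g : ℕ → ℝ≥0∞) : (∑' j, f j) * ∑' l, g l = ∑' j, ∑' l, f j * g l := by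
    simp only [ENNReal.tsum_mul_left, ENNReal.tsum_mul_right]
  simp only [ENNReal.rpow_two, sq (tsum _), hmul]
  rw [ENNReal.tsum_comm]
  refine ENNReal.tsum_le_tsum fun j => ?_
  rw [ENNReal.tsum_comm]
  refine ENNReal.tsum_le_tsum fun l => ?_
  have h := tsum_mul_mul_rpow_le (fun k => x k j ^ 2) (fun k => x k l ^ 2) (fun _ => 0)
    (u := 1 / 2) (v := 1 / 2) (w := 0) (by norm_num) (by norm_num) le_rfl (by norm_num)
  simpa [← ENNReal.rpow_natCast_mul] using h

/-- Interpolation of mixed norms between the exponents `(2, 2)`, `(1, 2)` and `(2, 1)`. -/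
lemma tsum_tsum_rpow_interpolation (x : ℕ → ℕ → ℝ≥0∞) {p q : ℝ} (hp : 1 ≤ p) (hp2 : p ≤ 2)
    (hq : 1 ≤ q) (hq2 : q ≤ 2) (hpq : 1 / p + 1 / q ≤ 3 / 2) :
    (∑' k, (∑' j, x k j ^ q) ^ (p / q)) ^ (1 / p) ≤
      (∑' k, ∑' j, x k j ^ (2 : ℝ)) ^ (3 / 2 - 1 / p - 1 / q) *
      (∑' k, (∑' j, x k j ^ (2 : ℝ)) ^ (1 / 2 : ℝ)) ^ (2 / p - 1) *
      (∑' k, (∑' j, x k j) ^ (2 : ℝ)) ^ (1 / q - 1 / 2) := by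
  have hp0 : 0 < p := by linarith
  have hq0 : 0 < q := by linarith
  have hpi : 1 / 2 ≤ 1 / p := one_div_le_one_div_of_le hp0 hp2
  have hqi : 1 / 2 ≤ 1 / q := one_div_le_one_div_of_le hq0 hq2
  let S := fun k => ∑' j, x k j ^ (2 : ℝ)
  let T := fun k => ∑' j, x k j
  have inner (k : ℕ) : ∑' j, x k j ^ q ≤ S k ^ (q - 1) * T k ^ (2 - q) := by
    have h := tsum_mul_mul_rpow_le (fun j => x k j ^ (2 : ℝ)) (fun j => x k j) (fun _ => 0)
      (u := q - 1) (v := 2 - q) (w := 0) (by linarith) (by linarith) le_rfl (by ring)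
    have h' (j : ℕ) : x k j ^ q = (x k j ^ (2 : ℝ)) ^ (q - 1) * x k j ^ (2 - q) := by
      rw [← ENNReal.rpow_mul, ← ENNReal.rpow_add_of_nonneg _ _ (by linarith) (by linarith)]
      ring_nf
    simpa only [h', ENNReal.rpow_zero, mul_one] using h
  have hu : 0 ≤ p * (3 / 2 - 1 / p - 1 / q) := mul_nonneg hp0.le (by linarith)
  have hv : 0 ≤ p * (2 / p - 1) :=
    mul_nonneg hp0.le (by linarith [div_eq_mul_one_div 2 p])
  have hw : 0 ≤ p * (1 / q - 1 / 2) := mul_nonneg hp0.le (by linarith)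
  have outer (k : ℕ) : (∑' j, x k j ^ q) ^ (p / q) ≤
      S k ^ (p * (3 / 2 - 1 / p - 1 / q)) * (S k ^ (1 / 2 : ℝ)) ^ (p * (2 / p - 1)) *
        (T k ^ (2 : ℝ)) ^ (p * (1 / q - 1 / 2)) := by
    refine (ENNReal.rpow_le_rpow (inner k) (by positivity)).trans_eq ?_
    rw [ENNReal.mul_rpow_of_nonneg _ _ (by positivity)]
    simp only [← ENNReal.rpow_mul]
    rw [← ENNReal.rpow_add_of_nonneg _ _ hu (by positivity)]
    congr 2 <;> field_simp
    ring
  calc (∑' k, (∑' j, x k j ^ q) ^ (p / q)) ^ (1 / p)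
      ≤ ((∑' k, S k) ^ (p * (3 / 2 - 1 / p - 1 / q)) *
          (∑' k, S k ^ (1 / 2 : ℝ)) ^ (p * (2 / p - 1)) *
          (∑' k, T k ^ (2 : ℝ)) ^ (p * (1 / q - 1 / 2))) ^ (1 / p) := by
        gcongr
        exact (ENNReal.tsum_le_tsum outer).trans
          (tsum_mul_mul_rpow_le _ _ _ hu hv hw (by field_simp; ring))
    _ = _ := by
        have hpos : 0 ≤ 1 / p := by positivity
        have hcancel (t : ℝ) : p * t * (1 / p) = t := by field_simp
        simp only [ENNReal.mul_rpow_of_nonneg _ _ hpos, ← ENNReal.rpow_mul, hcancel]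
        rfl

end ENNReal

lemma sum_enorm_rpow_two (b : ℕ → ℝ) (n : ℕ) :
    ∑ j ∈ Finset.range n, ‖b j‖ₑ ^ (2 : ℝ) =
      ENNReal.ofReal (∑ j ∈ Finset.range n, b j ^ 2) := by
  rw [ENNReal.ofReal_sum_of_nonneg fun _ _ => sq_nonneg _]
  refine Finset.sum_congr rfl fun j _ => ?_
  rw [← sq_abs, ENNReal.ofReal_pow (abs_nonneg _), Real.enorm_eq_ofReal_abs, ENNReal.rpow_two]

namespace BilinBound

variable {a : ℕ → ℕ → ℝ} {M : ℝ}

lemma tsum_tsum_sq_le (h : BilinBound a M) :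
    ∑' k, ∑' j, ‖a k j‖ₑ ^ (2 : ℝ) ≤ ENNReal.ofReal M ^ (2 : ℝ) := by
  have h' := ENNReal.tsum_tsum_rpow_le_of_sum_range_le (x := fun k j => ‖a k j‖ₑ ^ (2 : ℝ))
    (C := ENNReal.ofReal M ^ (2 : ℝ)) (s := 1) fun m n => by
      simp only [ENNReal.rpow_one, sum_enorm_rpow_two]
      rw [← ENNReal.ofReal_sum_of_nonneg fun _ _ => Finset.sum_nonneg fun _ _ => sq_nonneg _,
        ENNReal.rpow_two, ← ENNReal.ofReal_pow h.nonneg]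
      exact ENNReal.ofReal_le_ofReal (h.sum_sum_sq_le m n)
  simpa only [ENNReal.rpow_one] using h'

lemma tsum_sqrt_tsum_sq_le (h : BilinBound a M) :
    ∑' k, (∑' j, ‖a k j‖ₑ ^ (2 : ℝ)) ^ (1 / 2 : ℝ) ≤ ENNReal.ofReal (√2 * M) := by
  refine ENNReal.tsum_tsum_rpow_le_of_sum_range_le fun m n => ?_
  have hsq (k : ℕ) : (∑ j ∈ Finset.range n, ‖a k j‖ₑ ^ (2 : ℝ)) ^ (1 / 2 : ℝ) =
      ENNReal.ofReal √(∑ j ∈ Finset.range n, a k j ^ 2) := by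
    rw [sum_enorm_rpow_two, ENNReal.ofReal_rpow_of_nonneg (Finset.sum_nonneg fun _ _ => sq_nonneg _)
      (by norm_num), Real.sqrt_eq_rpow]
  simp only [hsq]
  rw [← ENNReal.ofReal_sum_of_nonneg fun _ _ => Real.sqrt_nonneg _]
  exact ENNReal.ofReal_le_ofReal (h.sum_sqrt_le m n)

theorem mixed_norm_le (h : BilinBound a M) {p q : ℝ} (hp1 : 1 ≤ p) (hp2 : p ≤ 2) (hq1 : 1 ≤ q)
    (hq2 : q ≤ 2) (hpq : 1 / p + 1 / q ≤ 3 / 2) :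
    (∑' k, (∑' j, ‖a k j‖ₑ ^ q) ^ (p / q)) ^ (1 / p) ≤
      ENNReal.ofReal (2 ^ (1 / p + 1 / q - 1) * M) := by
  have hpi : 1 / 2 ≤ 1 / p := one_div_le_one_div_of_le (by linarith) hp2
  have hqi : 1 / 2 ≤ 1 / q := one_div_le_one_div_of_le (by linarith) hq2
  have hu : 0 ≤ 3 / 2 - 1 / p - 1 / q := by linarith
  have hv : 0 ≤ 2 / p - 1 := by linarith [div_eq_mul_one_div 2 p]
  have hw : 0 ≤ 1 / q - 1 / 2 := by linarith
  have hM := h.nonneg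
  calc (∑' k, (∑' j, ‖a k j‖ₑ ^ q) ^ (p / q)) ^ (1 / p)
      ≤ (ENNReal.ofReal M ^ (2 : ℝ)) ^ (3 / 2 - 1 / p - 1 / q) *
          ENNReal.ofReal (√2 * M) ^ (2 / p - 1) *
          (ENNReal.ofReal (√2 * M) ^ (2 : ℝ)) ^ (1 / q - 1 / 2) := by
        refine (ENNReal.tsum_tsum_rpow_interpolation _ hp1 hp2 hq1 hq2 hpq).trans ?_
        gcongr
        · exact h.tsum_tsum_sq_le
        · exact h.tsum_sqrt_tsum_sq_le
        · refine (ENNReal.tsum_tsum_sq_le _).trans ?_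
          gcongr
          exact h.transpose.tsum_sqrt_tsum_sq_le
    _ = ENNReal.ofReal M ^ (1 : ℝ) * ENNReal.ofReal √2 ^ (2 * (1 / p + 1 / q - 1)) := by
        rw [ENNReal.ofReal_mul (Real.sqrt_nonneg 2)]
        simp only [← ENNReal.rpow_mul]
        rw [mul_assoc, ← ENNReal.rpow_add_of_nonneg _ _ hv (by positivity),
          ENNReal.mul_rpow_of_nonneg _ _ (by positivity), mul_left_comm,
          ← ENNReal.rpow_add_of_nonneg _ _ (by positivity) (by positivity), mul_comm]
        congr 2 <;> ring
    _ = ENNReal.ofReal (2 ^ (1 / p + 1 / q - 1) * M) := by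
        rw [ENNReal.rpow_one, ENNReal.ofReal_mul (by positivity), mul_comm,
          ENNReal.ofReal_rpow_of_nonneg (Real.sqrt_nonneg 2) (by linarith),
          Real.rpow_mul (Real.sqrt_nonneg 2), Real.rpow_two, Real.sq_sqrt zero_le_two]

end BilinBound

lemma norm_sum_smul_unitVec_le (m : ℕ) {σ : ℕ → ℝ} (hσ : ∀ k, |σ k| ≤ 1) :
    ‖∑ k ∈ Finset.range m, σ k • unitVec ℝ k‖ ≤ 1 := by
  rw [← ZeroAtInftyContinuousMap.norm_toBCF_eq_norm, BoundedContinuousFunction.norm_le zero_le_one]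
  intro j
  have h : (∑ k ∈ Finset.range m, σ k • unitVec ℝ k) j =
      ∑ k ∈ Finset.range m, σ k * if j = k then 1 else 0 := by
    induction m with
    | zero => simp
    | succ m ih =>
      rw [Finset.sum_range_succ, Finset.sum_range_succ, ZeroAtInftyContinuousMap.add_apply, ih]
      rfl
  change ‖(∑ k ∈ Finset.range m, σ k • unitVec ℝ k) j‖ ≤ 1
  rw [h]
  simp only [mul_ite, mul_one, mul_zero, Finset.sum_ite_eq]
  split_ifs
  · exact hσ j
  · simp

lemma bilinBound_unitVec
    (A : ContinuousMultilinearMap ℝ (fun _ : Fin 2 => ZeroAtInftyContinuousMap ℕ ℝ) ℝ) :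
    BilinBound (fun k j => A ![unitVec ℝ k, unitVec ℝ j]) ‖A‖ := by
  intro m n σ τ hσ hτ
  have hfst (y : ZeroAtInftyContinuousMap ℕ ℝ) :
      A ![∑ k ∈ Finset.range m, σ k • unitVec ℝ k, y] =
        ∑ k ∈ Finset.range m, σ k * A ![unitVec ℝ k, y] := by
    have hupd (x : ZeroAtInftyContinuousMap ℕ ℝ) : Function.update ![0, y] 0 x = ![x, y] := by
      funext i
      fin_cases i <;> rfl
    simpa only [map_smul, ContinuousMultilinearMap.toContinuousLinearMap_apply, hupd,
      smul_eq_mul] using map_sum (A.toContinuousLinearMap ![0, y] 0) (fun k => σ k • unitVec ℝ k)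
      (Finset.range m)
  have hsnd (x : ZeroAtInftyContinuousMap ℕ ℝ) :
      A ![x, ∑ j ∈ Finset.range n, τ j • unitVec ℝ j] =
        ∑ j ∈ Finset.range n, τ j * A ![x, unitVec ℝ j] := by
    have hupd (y : ZeroAtInftyContinuousMap ℕ ℝ) : Function.update ![x, 0] 1 y = ![x, y] := by
      funext i
      fin_cases i <;> rfl
    simpa only [map_smul, ContinuousMultilinearMap.toContinuousLinearMap_apply, hupd,
      smul_eq_mul] using map_sum (A.toContinuousLinearMap ![x, 0] 1) (fun j => τ j • unitVec ℝ j)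
      (Finset.range n)
  calc _ = A ![∑ k ∈ Finset.range m, σ k • unitVec ℝ k,
        ∑ j ∈ Finset.range n, τ j • unitVec ℝ j] := by
        simp only [hfst, hsnd, Finset.mul_sum, mul_assoc]
    _ ≤ ‖A‖ * ∏ _i : Fin 2, (1 : ℝ) :=
        (le_abs_self _).trans <| A.le_opNorm_mul_prod_of_le fun i => by
          fin_cases i
          · exact norm_sum_smul_unitVec_le m hσ
          · exact norm_sum_smul_unitVec_le n hτ
    _ = ‖A‖ := by simp

/-- **Theorem 6.3, inequality (real case).** Let `1 ≤ p, q ≤ 2` with `1/p + 1/q ≤ 3/2`. Then for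
every continuous bilinear form `A : c₀ × c₀ → ℝ`,
`(Σ_k (Σ_j |A(e_k,e_j)|^q)^{p/q})^{1/p} ≤ 2^{1/p + 1/q - 1} ‖A‖`. -/
theorem bilinear_real_sharp_inequality (p q : ℝ)
    (hp1 : 1 ≤ p) (hp2 : p ≤ 2) (hq1 : 1 ≤ q) (hq2 : q ≤ 2)
    (hpq : 1 / p + 1 / q ≤ 3 / 2)
    (A : ContinuousMultilinearMap ℝ (fun _ : Fin 2 => ZeroAtInftyContinuousMap ℕ ℝ) ℝ) :
    (∑' k : ℕ, (∑' j : ℕ,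
        (‖A ![unitVec ℝ k, unitVec ℝ j]‖₊ : ℝ≥0∞) ^ q) ^ (p / q)) ^ (1 / p) ≤
      ENNReal.ofReal (2 ^ (1 / p + 1 / q - 1) * ‖A‖) := by
  exact (bilinBound_unitVec A).mixed_norm_le hp1 hp2 hq1 hq2 hpq
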